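/- arXiv:2008.00500 — 3 statements merged into one kernel-verified Lean document; each statement's English description precedes it below -/
import Mathlib

section
/- Let S, Z, A be finite nonempty sets, X the set of probability vectors on S, and β ∈ [0,1). Let σ : Z × Z × X × A → ℝ be nonnegative with Σ_{z'∈Z} σ(z',z,x,a) = 1 for all (z,x,a), let Λ : Z × Z × X × A → X be any belief-update map, let r : Z × X × A → ℝ be bounded, and for each z ∈ Z let μ(·|z) be a Borel probability measure on ℝ^A with integrable coordinates. Define (HQ)(z,x,a) = r(z,x,a) + β Σ_{z'∈Z} σ(z',z,x,a) ∫ max_{a'∈A} ( Q(z', Λ(z',z,x,a), a') + ε(a') ) dμ(ε|z'). If Q and Q' are bounded functions Z × X × A → ℝ satisfying HQ = Q and HQ' = Q', then Q = Q'. -/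
open MeasureTheory

/-- The maximum of finitely many integrable functions is integrable. -/
theorem integrable_iSup_of_fintype {Ω A : Type*} [MeasurableSpace Ω] [Fintype A] [Nonempty A]
    {μ : Measure Ω} {f : A → Ω → ℝ} (hf : ∀ a, Integrable (f a) μ) :
    Integrable (fun ω => ⨆ a, f a ω) μ := by
  refine (integrable_finsetSum Finset.univ fun a _ => (hf a).abs).mono'
    (AEMeasurable.iSup fun a => (hf a).aemeasurable).aestronglyMeasurable
    (Filter.Eventually.of_forall fun ω => ?_)
  obtain ⟨a, ha⟩ := exists_eq_ciSup_of_finite (f := fun a => f a ω)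
  rw [← ha]
  exact Finset.single_le_sum (f := fun a => |f a ω|) (fun a _ => abs_nonneg _) (Finset.mem_univ a)

/-- The expected perturbed maximum is monotone and translation equivariant in the values. -/
theorem integral_iSup_add_le {A : Type*} [Fintype A] [Nonempty A] {μ : Measure (A → ℝ)}
    [IsProbabilityMeasure μ] (hμ : ∀ a, Integrable (fun ε : A → ℝ => ε a) μ)
    {q q' : A → ℝ} {C : ℝ} (h : ∀ a, q a ≤ q' a + C) :
    ∫ ε, (⨆ a, (q a + ε a)) ∂μ ≤ ∫ ε, (⨆ a, (q' a + ε a)) ∂μ + C := by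
  have hint : ∀ p : A → ℝ, Integrable (fun ε : A → ℝ => ⨆ a, (p a + ε a)) μ := fun p =>
    integrable_iSup_of_fintype fun a => (integrable_const (p a)).add (hμ a)
  calc ∫ ε, (⨆ a, (q a + ε a)) ∂μ ≤ ∫ ε, ((⨆ a, (q' a + ε a)) + C) ∂μ := by
        refine integral_mono (hint q) ((hint q').add (integrable_const C)) fun ε => ?_
        refine ciSup_le fun a => ?_
        have := le_ciSup (Set.finite_range fun a => q' a + ε a).bddAbove a
        linarith [h a]
    _ = _ := by rw [integral_add (hint q') (integrable_const C)]; simp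

/-- The expected perturbed maximum is 1-Lipschitz for the supremum distance. -/
theorem abs_integral_iSup_add_sub_le {A : Type*} [Fintype A] [Nonempty A] {μ : Measure (A → ℝ)}
    [IsProbabilityMeasure μ] (hμ : ∀ a, Integrable (fun ε : A → ℝ => ε a) μ)
    {q q' : A → ℝ} {C : ℝ} (h : ∀ a, |q a - q' a| ≤ C) :
    |∫ ε, (⨆ a, (q a + ε a)) ∂μ - ∫ ε, (⨆ a, (q' a + ε a)) ∂μ| ≤ C := by
  have h₁ := integral_iSup_add_le (q := q) (q' := q') (C := C) hμ fun a => by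
    linarith [(abs_le.1 (h a)).2]
  have h₂ := integral_iSup_add_le (q := q') (q' := q) (C := C) hμ fun a => by
    linarith [(abs_le.1 (h a)).1]
  exact abs_le.2 ⟨by linarith, by linarith⟩

/-- The soft Bellman operator has at most one bounded fixed point
(uniqueness part of the fixed-point claim, Theorem 2 of the paper). -/
theorem soft_bellman_fixed_point_unique
    {S Z A : Type*} [Fintype S] [Fintype Z] [Fintype A]
    [Nonempty S] [Nonempty Z] [Nonempty A]
    (β : ℝ) (hβ0 : 0 ≤ β) (hβ1 : β < 1)
    (σ : Z → Z → stdSimplex ℝ S → A → ℝ)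
    (hσ0 : ∀ z' z x a, 0 ≤ σ z' z x a)
    (hσ1 : ∀ z x a, ∑ z' : Z, σ z' z x a = 1)
    (Λ : Z → Z → stdSimplex ℝ S → A → stdSimplex ℝ S)
    (r : Z → stdSimplex ℝ S → A → ℝ)
    (hr : ∃ B : ℝ, ∀ z x a, |r z x a| ≤ B)
    (μ : Z → Measure (A → ℝ)) [∀ z, IsProbabilityMeasure (μ z)]
    (hμint : ∀ z a, Integrable (fun ε : A → ℝ => ε a) (μ z))
    (H : (Z → stdSimplex ℝ S → A → ℝ) → (Z → stdSimplex ℝ S → A → ℝ))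
    (hH : ∀ Q z x a, H Q z x a =
      r z x a + β * ∑ z' : Z, σ z' z x a *
        ∫ ε, (⨆ a' : A, (Q z' (Λ z' z x a) a' + ε a')) ∂(μ z'))
    (Q Q' : Z → stdSimplex ℝ S → A → ℝ)
    (hQb : ∃ B : ℝ, ∀ z x a, |Q z x a| ≤ B)
    (hQ'b : ∃ B : ℝ, ∀ z x a, |Q' z x a| ≤ B)
    (hQ : H Q = Q) (hQ' : H Q' = Q') :
    Q = Q' := by
  have contract : ∀ C : ℝ, (∀ z x a, |Q z x a - Q' z x a| ≤ C) →
      ∀ z x a, |Q z x a - Q' z x a| ≤ β * C := by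
    intro C hC z x a
    rw [← congrFun (congrFun (congrFun hQ z) x) a, ← congrFun (congrFun (congrFun hQ' z) x) a,
      hH, hH, add_sub_add_left_eq_sub, ← mul_sub, ← Finset.sum_sub_distrib, abs_mul,
      abs_of_nonneg hβ0]
    refine mul_le_mul_of_nonneg_left ?_ hβ0
    calc _ ≤ ∑ z', σ z' z x a * C := by
          refine (Finset.abs_sum_le_sum_abs _ _).trans (Finset.sum_le_sum fun z' _ => ?_)
          rw [← mul_sub, abs_mul, abs_of_nonneg (hσ0 _ _ _ _)]
          exact mul_le_mul_of_nonneg_left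
            (abs_integral_iSup_add_sub_le (hμint z') fun a' => hC _ _ _) (hσ0 _ _ _ _)
      _ = C := by rw [← Finset.sum_mul, hσ1, one_mul]
  obtain ⟨B, hB⟩ := hQb
  obtain ⟨B', hB'⟩ := hQ'b
  have iterate : ∀ n : ℕ, ∀ z x a, |Q z x a - Q' z x a| ≤ β ^ n * (B + B') := by
    intro n
    induction n with
    | zero =>
      intro z x a
      simpa using (abs_sub _ _).trans (add_le_add (hB z x a) (hB' z x a))
    | succ n ih => simpa only [pow_succ', mul_assoc] using contract _ ih
  funext z x a
  have hlim := (tendsto_pow_atTop_nhds_zero_of_lt_one hβ0 hβ1).mul_const (B + B')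
  rw [zero_mul] at hlim
  exact sub_eq_zero.1 (abs_nonpos_iff.1 (ge_of_tendsto' hlim fun n => iterate n z x a))
end

section
/- Let A be a finite nonempty set and μ a Borel probability measure on ℝ^A such that each coordinate ε ↦ ε(a) is μ-integrable and, for every q : A → ℝ, the tie set { ε : ∃ a ≠ a', q(a) + ε(a) = q(a') + ε(a') } is μ-null. Define V̄(q) = ∫ max_{a∈A} ( q(a) + ε(a) ) dμ(ε) and the choice probabilities π(a|q) = μ{ ε : q(a) + ε(a) ≥ q(a') + ε(a') for all a' ∈ A }. Then V̄ : ℝ^A → ℝ is differentiable at every q, with total derivative the linear map v ↦ Σ_{a∈A} π(a|q) · v(a); in particular ∂V̄/∂q(a) = π(a|q). -/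
open MeasureTheory

/-- The finite maximum is nonexpansive for the sup norm. -/
theorem lipschitzWith_iSup_pi {A : Type*} [Fintype A] [Nonempty A] :
    LipschitzWith 1 (fun x : A → ℝ => ⨆ a, x a) := by
  refine LipschitzWith.of_le_add fun x y => ciSup_le fun a => ?_
  have h₁ : y a ≤ ⨆ a, y a := le_ciSup (Set.finite_range y).bddAbove a
  have h₂ : dist (x a) (y a) ≤ dist x y := dist_le_pi_dist x y a
  have h₃ := (le_abs_self (x a - y a)).trans_eq (Real.dist_eq _ _).symm
  linarith

/-- Where the maximum is attained at a single coordinate, its derivative is the projection onto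
that coordinate. -/
theorem hasFDerivAt_iSup_pi {A : Type*} [Fintype A] {x : A → ℝ} {a : A}
    (h : ∀ b, b ≠ a → x b < x a) :
    HasFDerivAt (fun y : A → ℝ => ⨆ b, y b)
      (ContinuousLinearMap.proj (R := ℝ) (φ := fun _ : A => ℝ) a) x := by
  refine HasFDerivAt.congr_of_eventuallyEq (ContinuousLinearMap.hasFDerivAt _) ?_
  have hev : ∀ᶠ y in nhds x, ∀ b, b ≠ a → y b < y a := by
    refine Filter.eventually_all.2 fun b => ?_
    by_cases hb : b = a
    · simp [hb]
    · filter_upwards [(continuous_apply b).continuousAt.eventually_lt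
        (continuous_apply a).continuousAt (h b hb)] with y hy _ using hy
  filter_upwards [hev] with y hy
  have : Nonempty A := ⟨a⟩
  refine le_antisymm (ciSup_le fun b => ?_) (le_ciSup (Set.finite_range y).bddAbove a)
  obtain rfl | hb := eq_or_ne b a
  · exact le_rfl
  · exact (hy b hb).le

/-- A simple function given as a finite sum of indicators is integrable, with the expected
integral. -/
theorem integrable_and_integral_sum_indicator_const {A Ω E : Type*} [Fintype A]
    [MeasurableSpace Ω] [NormedAddCommGroup E] [NormedSpace ℝ E] [CompleteSpace E]
    {μ : Measure Ω} [IsFiniteMeasure μ] {S : A → Set Ω} (hS : ∀ a, MeasurableSet (S a))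
    (c : A → E) :
    Integrable (fun ω => ∑ a, (S a).indicator (fun _ => c a) ω) μ ∧
      ∫ ω, ∑ a, (S a).indicator (fun _ => c a) ω ∂μ = ∑ a, (μ (S a)).toReal • c a := by
  have hind (a : A) : Integrable ((S a).indicator fun _ => c a) μ :=
    (integrable_const (c a)).indicator (hS a)
  refine ⟨integrable_finsetSum _ fun a _ => hind a, ?_⟩
  rw [integral_finsetSum _ fun a _ => hind a]
  exact Finset.sum_congr rfl fun a _ => integral_indicator_const _ (hS a)

/-- Differentiation under the integral sign for an integrand that is Lipschitz in the parameter and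
whose derivative at `x₀` is almost everywhere `L a` on the cells `S a` of a finite partition. -/
theorem hasFDerivAt_integral_of_ae_partition {A Ω E : Type*} [Fintype A] [MeasurableSpace Ω]
    [NormedAddCommGroup E] [NormedSpace ℝ E] {μ : Measure Ω} [IsFiniteMeasure μ]
    {F : E → Ω → ℝ} {x₀ : E} {S : A → Set Ω} {L : A → E →L[ℝ] ℝ} {C : NNReal}
    (hF_meas : ∀ x, AEStronglyMeasurable (F x) μ) (hF_int : Integrable (F x₀) μ)
    (hF_lip : ∀ ω, LipschitzWith C (F · ω)) (hS : ∀ a, MeasurableSet (S a))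
    (hF_diff : ∀ᵐ ω ∂μ, ∃ a, (∀ b, ω ∈ S b ↔ b = a) ∧ HasFDerivAt (F · ω) (L a) x₀) :
    HasFDerivAt (fun x => ∫ ω, F x ω ∂μ) (∑ a, (μ (S a)).toReal • L a) x₀ := by
  classical
  obtain ⟨hsum, hsum_eq⟩ := integrable_and_integral_sum_indicator_const (μ := μ) hS L
  have hdiff : ∀ᵐ ω ∂μ, HasFDerivAt (F · ω) (∑ a, (S a).indicator (fun _ => L a) ω) x₀ := by
    filter_upwards [hF_diff] with ω ⟨a, ha, h⟩
    simpa [Set.indicator_apply, ha] using h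
  have hmain := (hasFDerivAt_integral_of_dominated_loc_of_lip (μ := μ) (bound := fun _ => (C : ℝ))
    Filter.univ_mem (.of_forall hF_meas) hF_int hsum.aestronglyMeasurable
    (.of_forall fun ω => by simpa using hF_lip ω) (integrable_const _) hdiff).2
  exact hsum_eq ▸ hmain

/-- The social surplus function `V̄(q) = ∫ max_a (q a + ε a) dμ` is differentiable with
derivative given by the conditional choice probabilities: `∂V̄/∂q(a) = π(a|q)`. -/
theorem surplus_hasFDerivAt_choice_probabilities
    {A : Type*} [Fintype A] [Nonempty A]
    (μ : Measure (A → ℝ)) [IsProbabilityMeasure μ]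
    (hμint : ∀ a, Integrable (fun ε : A → ℝ => ε a) μ)
    (hties : ∀ q : A → ℝ,
      μ {ε : A → ℝ | ∃ a a', a ≠ a' ∧ q a + ε a = q a' + ε a'} = 0)
    (q : A → ℝ) :
    HasFDerivAt (fun p : A → ℝ => ∫ ε, (⨆ a : A, (p a + ε a)) ∂μ)
      (∑ a : A, (μ {ε : A → ℝ | ∀ a' : A, q a' + ε a' ≤ q a + ε a}).toReal •
        ContinuousLinearMap.proj (R := ℝ) (φ := fun _ : A => ℝ) a) q := by
  have hmeas (p : A → ℝ) : AEStronglyMeasurable (fun ε : A → ℝ => ⨆ a, (p a + ε a)) μ :=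
    (lipschitzWith_iSup_pi.continuous.comp (continuous_const_add p)).aestronglyMeasurable
  refine hasFDerivAt_integral_of_ae_partition (C := 1)
    (S := fun a => {ε : A → ℝ | ∀ a', q a' + ε a' ≤ q a + ε a}) hmeas ?_ (fun ε => ?_)
    (fun a => ?_) ?_
  · have hid : Integrable (fun ε : A → ℝ => ε) μ := Integrable.of_eval hμint
    refine ((integrable_const q).add hid).mono (hmeas q) (.of_forall fun ε => ?_)
    simpa using lipschitzWith_iSup_pi.norm_sub_le (q + ε) 0
  · refine LipschitzWith.of_dist_le_mul fun x y => ?_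
    simpa using lipschitzWith_iSup_pi.dist_le_mul (x + ε) (y + ε)
  · simp only [Set.ofPred_forall]
    exact MeasurableSet.iInter fun b => measurableSet_le (by fun_prop) (by fun_prop)
  · filter_upwards [measure_eq_zero_iff_ae_notMem.1 (hties q)] with ε hε
    obtain ⟨a, ha⟩ := Finite.exists_max fun a => q a + ε a
    have hlt : ∀ b, b ≠ a → (q + ε) b < (q + ε) a := fun b hb =>
      lt_of_le_of_ne (ha b) fun heq => hε ⟨b, a, hb, heq⟩
    refine ⟨a, fun b => ⟨fun hb => ?_, ?_⟩,
      (hasFDerivAt_comp_add_right ε).2 (hasFDerivAt_iSup_pi hlt)⟩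
    · by_contra hne
      exact (hlt b hne).not_ge (hb a)
    · rintro rfl
      exact ha
end

section
/- Let A be a finite nonempty set and let μ be the product over a ∈ A of standard Gumbel measures on ℝ (each with density ε ↦ exp(−ε)·exp(−exp(−ε)) with respect to Lebesgue measure). Then for every q : A → ℝ and every a ∈ A, μ{ ε ∈ ℝ^A : q(a) + ε(a) ≥ q(a') + ε(a') for all a' ∈ A } = exp(q(a)) / Σ_{a'∈A} exp(q(a')). -/
open MeasureTheory

/-- The standard Gumbel measure on `ℝ`, with density `ε ↦ exp(−ε)·exp(−exp(−ε))`
with respect to Lebesgue measure. -/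
noncomputable def stdGumbel : Measure ℝ :=
  volume.withDensity fun ε => ENNReal.ofReal (Real.exp (-ε) * Real.exp (-Real.exp (-ε)))

lemma hasDerivAt_exp_neg_mul_exp_neg_div {c : ℝ} (hc : c ≠ 0) (x : ℝ) :
    HasDerivAt (fun x => Real.exp (-(c * Real.exp (-x))) / c)
      (Real.exp (-x) * Real.exp (-(c * Real.exp (-x)))) x := by
  have h := ((((hasDerivAt_id x).neg.exp.const_mul c).neg).exp).div_const c
  refine h.congr_deriv ?_
  simp only [Pi.neg_apply, id]
  field_simp

lemma strictMono_exp_neg_mul_exp_neg_div {c : ℝ} (hc : 0 < c) :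
    StrictMono fun x => Real.exp (-(c * Real.exp (-x))) / c := by
  intro x y hxy
  dsimp only
  gcongr

lemma range_exp_neg_mul_exp_neg_div {c : ℝ} (hc : 0 < c) :
    Set.range (fun x => Real.exp (-(c * Real.exp (-x))) / c) = Set.Ioo 0 (1 / c) := by
  ext y
  constructor
  · rintro ⟨x, rfl⟩
    refine ⟨by positivity, ?_⟩
    dsimp only
    gcongr
    rw [Real.exp_lt_one_iff]
    have := Real.exp_pos (-x)
    nlinarith
  · rintro ⟨h0, h1⟩
    have hy : c * y < 1 := by rwa [lt_div_iff₀ hc, mul_comm] at h1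
    have hl : Real.log (c * y) < 0 := Real.log_neg (by positivity) hy
    refine ⟨-Real.log (-Real.log (c * y) / c), ?_⟩
    dsimp only
    rw [neg_neg, Real.exp_log (div_pos (by linarith) hc), mul_div_cancel₀ _ hc.ne', neg_neg,
      Real.exp_log (by positivity), mul_div_cancel_left₀ _ hc.ne']

lemma lintegral_exp_neg_mul_exp_neg {c : ℝ} (hc : 0 < c) :
    ∫⁻ x, ENNReal.ofReal (Real.exp (-x) * Real.exp (-(c * Real.exp (-x)))) =
      ENNReal.ofReal (1 / c) := by
  have h := lintegral_deriv_eq_volume_image_of_monotoneOn MeasurableSet.univ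
    (fun x _ => (hasDerivAt_exp_neg_mul_exp_neg_div hc.ne' x).hasDerivWithinAt)
    ((strictMono_exp_neg_mul_exp_neg_div hc).monotone.monotoneOn _)
  rw [Set.image_univ, range_exp_neg_mul_exp_neg_div hc, Real.volume_Ioo, sub_zero,
    setLIntegral_univ] at h
  exact h

lemma stdGumbel_Iic (t : ℝ) :
    stdGumbel (Set.Iic t) = ENNReal.ofReal (Real.exp (-Real.exp (-t))) := by
  have hmono := strictMono_exp_neg_mul_exp_neg_div one_pos
  have h := lintegral_deriv_eq_volume_image_of_monotoneOn (measurableSet_Iic (a := t))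
    (fun x _ => (hasDerivAt_exp_neg_mul_exp_neg_div one_ne_zero x).hasDerivWithinAt)
    (hmono.monotone.monotoneOn _)
  have himage : (fun x => Real.exp (-(1 * Real.exp (-x))) / 1) '' Set.Iic t =
      Set.Ioc 0 (Real.exp (-Real.exp (-t))) := by
    have hrange := range_exp_neg_mul_exp_neg_div one_pos
    ext y
    constructor
    · rintro ⟨x, hx, rfl⟩
      exact ⟨by positivity, by simpa using hx⟩
    · rintro ⟨h0, h1⟩
      have hy : y < 1 := h1.trans_lt (by simp [Real.exp_pos])
      obtain ⟨x, rfl⟩ : y ∈ Set.range fun x => Real.exp (-(1 * Real.exp (-x))) / 1 := by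
        rw [hrange]
        exact ⟨h0, by simpa using hy⟩
      exact ⟨x, by simpa using h1, rfl⟩
  rw [himage, Real.volume_Ioc, sub_zero] at h
  rw [stdGumbel, withDensity_apply _ measurableSet_Iic, ← h]
  simp only [one_mul]

instance isProbabilityMeasure_stdGumbel : IsProbabilityMeasure stdGumbel := by
  constructor
  rw [stdGumbel, withDensity_apply _ MeasurableSet.univ, setLIntegral_univ]
  simpa using lintegral_exp_neg_mul_exp_neg one_pos

/-- If all coordinates are independent with law `ν`, the probability that the `a`-th one exceeds
every other one after shifting by `q` is obtained by conditioning on the `a`-th coordinate. -/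
lemma pi_argmax_eq_lintegral {A : Type*} [Fintype A] [DecidableEq A] (ν : Measure ℝ)
    [IsProbabilityMeasure ν] (q : A → ℝ) (a : A) :
    (Measure.pi fun _ : A => ν) {ε : A → ℝ | ∀ a' : A, q a' + ε a' ≤ q a + ε a} =
      ∫⁻ t, ∏ i : {i // i ≠ a}, ν (Set.Iic (q a + t - q i)) ∂ν := by
  have hS : MeasurableSet {ε : A → ℝ | ∀ a' : A, q a' + ε a' ≤ q a + ε a} := by
    rw [Set.ofPred_forall]
    exact MeasurableSet.iInter fun a' => measurableSet_le (by fun_prop) (by fun_prop)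
  have hmp := (measurePreserving_piEquivPiSubtypeProd (fun _ : A => ν) (· = a)).symm
  rw [← hmp.measure_preimage hS.nullMeasurableSet,
    Measure.prod_apply (hmp.measurable hS)]
  have hsection (x : {i // i = a} → ℝ) :
      Prod.mk x ⁻¹' ((MeasurableEquiv.piEquivPiSubtypeProd (fun _ : A => ℝ) (· = a)).symm ⁻¹'
        {ε : A → ℝ | ∀ a' : A, q a' + ε a' ≤ q a + ε a}) =
      Set.univ.pi fun i : {i // i ≠ a} => Set.Iic (q a + x ⟨a, rfl⟩ - q i) := by
    ext y
    simp only [Set.mem_preimage, Set.mem_ofPred_eq, Set.mem_univ_pi, Set.mem_Iic,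
      MeasurableEquiv.piEquivPiSubtypeProd_symm_apply, dite_true]
    constructor
    · rintro h ⟨i, hi⟩
      have := h i
      rw [dif_neg hi] at this
      linarith
    · intro h i
      by_cases hi : i = a
      · subst hi
        simp
      · rw [dif_neg hi]
        linarith [h ⟨i, hi⟩]
  simp only [hsection, Measure.pi_pi]
  have hmeas : Measurable fun t => ∏ i : {i // i ≠ a}, ν (Set.Iic (q a + t - q i)) := by
    refine Finset.measurable_prod _ fun i _ => Monotone.measurable fun s t hst => ?_
    exact measure_mono (Set.Iic_subset_Iic.2 (by linarith))
  convert (measurePreserving_eval (fun _ : {i // i = a} => ν) ⟨a, rfl⟩).lintegral_comp hmeas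

/-- Under i.i.d. standard Gumbel perturbations, the probability that action `a` attains the
maximal perturbed payoff has the softmax (multinomial logit) form (Theorem 3 of the paper). -/
theorem gumbel_argmax_prob_softmax
    {A : Type*} [Fintype A] [Nonempty A]
    (q : A → ℝ) (a : A) :
    ((Measure.pi fun _ : A => stdGumbel)
        {ε : A → ℝ | ∀ a' : A, q a' + ε a' ≤ q a + ε a}).toReal =
      Real.exp (q a) / ∑ a' : A, Real.exp (q a') := by
  classical
  have hc : 0 < ∑ i, Real.exp (q i - q a) :=
    Finset.sum_pos (fun i _ => Real.exp_pos _) ⟨a, Finset.mem_univ a⟩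
  have hintegrand (t : ℝ) :
      ENNReal.ofReal (Real.exp (-t) * Real.exp (-Real.exp (-t))) *
          ∏ i : {i // i ≠ a}, stdGumbel (Set.Iic (q a + t - q i)) =
        ENNReal.ofReal
          (Real.exp (-t) * Real.exp (-((∑ i, Real.exp (q i - q a)) * Real.exp (-t)))) := by
    simp only [stdGumbel_Iic]
    rw [← ENNReal.ofReal_prod_of_nonneg fun i _ => (Real.exp_pos _).le,
      ← ENNReal.ofReal_mul (by positivity), ← Real.exp_sum, mul_assoc, ← Real.exp_add,
      Fintype.sum_eq_add_sum_subtype_ne _ a, sub_self, Real.exp_zero, add_mul, one_mul, neg_add,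
      Finset.sum_mul, Finset.sum_neg_distrib]
    simp only [← Real.exp_add]
    congr! 7
    ring
  rw [pi_argmax_eq_lintegral]
  nth_rw 1 [stdGumbel]
  rw [lintegral_withDensity_eq_lintegral_mul_non_measurable _ (by fun_prop)
    (Filter.Eventually.of_forall fun _ => ENNReal.ofReal_lt_top)]
  simp only [Pi.mul_apply, hintegrand]
  rw [lintegral_exp_neg_mul_exp_neg hc, ENNReal.toReal_ofReal (by positivity)]
  simp only [Real.exp_sub, ← Finset.sum_div]
  rw [one_div_div]
end
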